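/- Let f(x) = α x^n - β x^k + γ with α, β, γ > 0, n ≥ 3, and 1 ≤ k ≤ n-1, and suppose f has two distinct positive roots r₁ < r₂. Let x̄ satisfy r₁ ≤ x̄ ≤ r₂, and define δ = (k/n) x̄^{k+n} and ε = ((n+k)/n) x̄^k, so that ε > x̄^k. Then the function h(x) = αδ/(ε - x^k) - β x^k + γ satisfies h(x) ≥ f(x) for all x ≥ 0 with x^k < ε, and h has two positive zeros s₁ and s₂ with r₁ ≤ s₁ < s₂ ≤ r₂. -/

import Mathlib

/-- Strict weighted AM-GM inequality for two integer powers of one variable. -/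
theorem mul_pow_lt_mul_pow_add_sub {n k : ℕ} (hk : 1 ≤ k) (hkn : k < n) {t : ℝ}
    (ht : 0 ≤ t) (ht1 : t ≠ 1) :
    (n : ℝ) * t ^ k < k * t ^ n + (n - k) := by
  have hk0 : (0 : ℝ) < k := by exact_mod_cast hk
  have hkn' : (k : ℝ) < n := by exact_mod_cast hkn
  have htk : t ^ k ≠ 1 := by rwa [Ne, pow_eq_one_iff_of_nonneg ht (by omega)]
  have hpow : (t ^ k) ^ ((n : ℝ) / k) = t ^ n := by
    rw [← Real.rpow_natCast t k, ← Real.rpow_mul ht, mul_div_cancel₀ _ hk0.ne',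
      Real.rpow_natCast]
  have hb := one_add_mul_self_lt_rpow_one_add (s := t ^ k - 1) (p := (n : ℝ) / k)
    (by linarith [pow_nonneg ht k]) (sub_ne_zero.mpr htk) (by rwa [one_lt_div hk0])
  rw [add_sub_cancel, hpow] at hb
  have hb' := mul_lt_mul_of_pos_left hb hk0
  have heq : (k : ℝ) * (1 + n / k * (t ^ k - 1)) = k + n * (t ^ k - 1) := by
    field_simp
  linarith

/-- If a trinomial does not decrease from a positive zero `r` to `X > r`, its derivative at `X`
is positive. -/
theorem trinomial_deriv_pos_of_root_lt {n k : ℕ} (hk : 1 ≤ k) (hkn : k < n) {α β γ r X : ℝ}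
    (hα : 0 < α) (hr : 0 < r) (hrX : r < X) (hfr : α * r ^ n - β * r ^ k + γ = 0)
    (hfX : 0 ≤ α * X ^ n - β * X ^ k + γ) :
    k * (β * X ^ k) < n * (α * X ^ n) := by
  have hX : 0 < X := hr.trans hrX
  obtain ⟨t, rfl⟩ : ∃ t, r = t * X := ⟨r / X, by field_simp⟩
  have ht : 0 < t := pos_of_mul_pos_left hr hX.le
  have ht1 : t < 1 := by nlinarith
  have hL := mul_pow_lt_mul_pow_add_sub hk hkn ht.le ht1.ne
  have htk : t ^ k < 1 := pow_lt_one₀ ht.le ht1 (by omega)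
  have hA : 0 < α * X ^ n := by positivity
  have hk0 : (0 : ℝ) < k := by exact_mod_cast hk
  rw [mul_pow, mul_pow] at hfr
  have h1 : β * X ^ k * (1 - t ^ k) ≤ α * X ^ n * (1 - t ^ n) := by linarith
  have h2 := mul_lt_mul_of_pos_left hL hA
  have h3 := mul_le_mul_of_nonneg_left h1 hk0.le
  exact lt_of_mul_lt_mul_right (a := 1 - t ^ k) (by linarith) (by linarith)

/-- If a trinomial does not increase from `X > 0` to a zero `r > X`, its derivative at `X`
is negative. -/
theorem trinomial_deriv_neg_of_lt_root {n k : ℕ} (hk : 1 ≤ k) (hkn : k < n) {α β γ r X : ℝ}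
    (hα : 0 < α) (hX : 0 < X) (hXr : X < r) (hfr : α * r ^ n - β * r ^ k + γ = 0)
    (hfX : 0 ≤ α * X ^ n - β * X ^ k + γ) :
    n * (α * X ^ n) < k * (β * X ^ k) := by
  obtain ⟨t, rfl⟩ : ∃ t, r = t * X := ⟨r / X, by field_simp⟩
  have ht1 : 1 < t := by nlinarith
  have hL := mul_pow_lt_mul_pow_add_sub hk hkn (by linarith) ht1.ne'
  have htk : 1 < t ^ k := one_lt_pow₀ ht1 (by omega)
  have hA : 0 < α * X ^ n := by positivity
  have hk0 : (0 : ℝ) < k := by exact_mod_cast hk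
  rw [mul_pow, mul_pow] at hfr
  have h1 : α * X ^ n * (t ^ n - 1) ≤ β * X ^ k * (t ^ k - 1) := by linarith
  have h2 := mul_lt_mul_of_pos_left hL hA
  have h3 := mul_le_mul_of_nonneg_left h1 hk0.le
  exact lt_of_mul_lt_mul_right (a := t ^ k - 1) (by linarith) (by linarith)

theorem pow_mul_sub_pow_le {n k : ℕ} (hk : 1 ≤ k) (hn : 1 ≤ n) {x X : ℝ}
    (hx : 0 ≤ x) (hX : 0 < X) :
    x ^ n * (((n : ℝ) + k) / n * X ^ k - x ^ k) ≤ (k : ℝ) / n * X ^ (k + n) := by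
  obtain ⟨t, rfl⟩ : ∃ t, x = t * X := ⟨x / X, by field_simp⟩
  have ht : 0 ≤ t := nonneg_of_mul_nonneg_left hx hX
  have hn0 : (0 : ℝ) < n := by exact_mod_cast hn
  have hL : ((n : ℝ) + k) * t ^ n ≤ n * t ^ (n + k) + k := by
    rcases eq_or_ne t 1 with rfl | ht1
    · simp
    · have := mul_pow_lt_mul_pow_add_sub hn (by omega : n < n + k) ht ht1
      push_cast at this
      linarith
  have hP : 0 < X ^ (k + n) / n := by positivity
  have h1 := mul_le_mul_of_nonneg_right hL hP.le
  have e1 : (t * X) ^ n * (((n : ℝ) + k) / n * X ^ k - (t * X) ^ k)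
      = (((n : ℝ) + k) * t ^ n - n * t ^ (n + k)) * (X ^ (k + n) / n) := by
    rw [mul_pow, mul_pow, pow_add, pow_add]
    field_simp
  have e2 : (k : ℝ) / n * X ^ (k + n) = k * (X ^ (k + n) / n) := by ring
  rw [e1, e2]
  linarith

/-- A quadratic `c - (βy - γ)(ε - y)` with `c > 0` that is negative at `y₀ < ε`, and nonnegative
at `a ≤ y₀` and, when `b < ε`, at `b ≥ y₀`, has two zeros below `ε` in `[a, b]`. -/
theorem exists_two_zeros_of_neg {β γ ε c a b y₀ : ℝ} (hc : 0 < c) (ha : a ≤ y₀) (hb : y₀ ≤ b)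
    (hy₀ε : y₀ < ε) (hy₀ : c - (β * y₀ - γ) * (ε - y₀) < 0)
    (hga : 0 ≤ c - (β * a - γ) * (ε - a))
    (hgb : b < ε → 0 ≤ c - (β * b - γ) * (ε - b)) :
    ∃ y₁ y₂, a ≤ y₁ ∧ y₁ < y₂ ∧ y₂ ≤ b ∧ y₂ < ε ∧
      c - (β * y₁ - γ) * (ε - y₁) = 0 ∧ c - (β * y₂ - γ) * (ε - y₂) = 0 := by
  have hcont : Continuous fun y : ℝ => c - (β * y - γ) * (ε - y) := by fun_prop
  obtain ⟨y₁, ⟨h1, h2⟩, h3⟩ :=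
    intermediate_value_Icc' ha hcont.continuousOn (Set.mem_Icc.mpr ⟨hy₀.le, hga⟩)
  have hm : 0 ≤ c - (β * min b ε - γ) * (ε - min b ε) := by
    rcases lt_or_ge b ε with hlt | hge
    · rw [min_eq_left hlt.le]
      exact hgb hlt
    · rw [min_eq_right hge]
      simpa using hc.le
  obtain ⟨y₂, ⟨h4, h5⟩, h6⟩ :=
    intermediate_value_Icc (le_min hb hy₀ε.le) hcont.continuousOn (Set.mem_Icc.mpr ⟨hy₀.le, hm⟩)
  dsimp only at h3 h6
  refine ⟨y₁, y₂, h1, (h2.trans h4).lt_of_ne ?_, h5.trans (min_le_left _ _),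
    (h5.trans (min_le_right _ _)).lt_of_ne ?_, h3, h6⟩
  · rintro rfl
    rw [le_antisymm h2 h4] at h3
    exact hy₀.ne h3
  · rintro rfl
    simp [hc.ne'] at h6


/-- **Hyperbolic majorant of the trinomial.** If `f(x) = α x^n - β x^k + γ` (with
`α, β, γ > 0`) has two distinct positive roots `r₁ < r₂` and `r₁ ≤ x̄ ≤ r₂`, then with
`δ = (k/n) x̄^{k+n}` and `ε = ((n+k)/n) x̄^k`, one has `ε > x̄^k`, the function
`h(x) = αδ/(ε - x^k) - β x^k + γ` dominates `f` wherever `0 ≤ x` and `x^k < ε`, and `h`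
has two positive zeros `s₁ < s₂` with `r₁ ≤ s₁ < s₂ ≤ r₂`. -/
theorem hyperbolic_majorant (n k : ℕ) (α β γ : ℝ)
    (hα : 0 < α) (hβ : 0 < β) (hγ : 0 < γ)
    (hn : 3 ≤ n) (hk1 : 1 ≤ k) (hk2 : k ≤ n - 1)
    (f : ℝ → ℝ) (hf : ∀ x : ℝ, f x = α * x ^ n - β * x ^ k + γ)
    (r₁ r₂ : ℝ) (hr₁ : 0 < r₁) (hr₁₂ : r₁ < r₂) (hfr₁ : f r₁ = 0) (hfr₂ : f r₂ = 0)
    (xb : ℝ) (hxb1 : r₁ ≤ xb) (hxb2 : xb ≤ r₂)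
    (δ ε : ℝ)
    (hδ : δ = ((k : ℝ) / (n : ℝ)) * xb ^ (k + n))
    (hε : ε = (((n : ℝ) + (k : ℝ)) / (n : ℝ)) * xb ^ k)
    (h : ℝ → ℝ)
    (hh : ∀ x : ℝ, h x = α * δ / (ε - x ^ k) - β * x ^ k + γ) :
    xb ^ k < ε ∧
      (∀ x : ℝ, 0 ≤ x → x ^ k < ε → f x ≤ h x) ∧
      ∃ s₁ s₂ : ℝ, r₁ ≤ s₁ ∧ s₁ < s₂ ∧ s₂ ≤ r₂ ∧ h s₁ = 0 ∧ h s₂ = 0 := by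
  have hkn : k < n := by omega
  have hX : 0 < xb := hr₁.trans_le hxb1
  have hk0 : (0 : ℝ) < k := by exact_mod_cast hk1
  have hn0 : (0 : ℝ) < n := by exact_mod_cast (by omega : 0 < n)
  have hY : 0 < xb ^ k := by positivity
  have hεY : ε = xb ^ k + (k : ℝ) / n * xb ^ k := by
    rw [hε]
    field_simp
  have hqY : 0 < (k : ℝ) / n * xb ^ k := by positivity
  have hlt : xb ^ k < ε := by linarith
  have hmaj : ∀ x : ℝ, 0 ≤ x → x ^ k < ε → f x ≤ h x := by
    intro x hx hxε
    have hle := pow_mul_sub_pow_le hk1 (by omega : 1 ≤ n) hx hX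
    rw [← hε, ← hδ] at hle
    have : α * x ^ n ≤ α * δ / (ε - x ^ k) := by
      rw [le_div_iff₀ (by linarith), mul_assoc]
      exact mul_le_mul_of_nonneg_left hle hα.le
    rw [hf, hh]
    linarith
  have hc : 0 < α * δ := by
    rw [hδ]
    positivity
  have hhg : ∀ x : ℝ, x ^ k < ε →
      h x * (ε - x ^ k) = α * δ - (β * x ^ k - γ) * (ε - x ^ k) := by
    intro x hx
    have : ε - x ^ k ≠ 0 := by linarith
    rw [hh]
    field_simp
    ring
  have hg_nonneg : ∀ r : ℝ, 0 < r → f r = 0 → r ^ k < ε →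
      0 ≤ α * δ - (β * r ^ k - γ) * (ε - r ^ k) := by
    intro r hr hfr hrε
    rw [← hhg r hrε]
    exact mul_nonneg (hfr ▸ hmaj r hr.le hrε) (by linarith)
  have hr₁k : r₁ ^ k ≤ xb ^ k := pow_le_pow_left₀ hr₁.le hxb1 k
  have hr₂k : xb ^ k ≤ r₂ ^ k := pow_le_pow_left₀ hX.le hxb2 k
  have hga := hg_nonneg r₁ hr₁ hfr₁ (hr₁k.trans_lt hlt)
  have hgb := hg_nonneg r₂ (hr₁.trans hr₁₂) hfr₂
  have hcY : α * δ = α * xb ^ n * ((k : ℝ) / n * xb ^ k) := by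
    rw [hδ, pow_add]
    ring
  have hA : 0 < α * xb ^ n := by positivity
  rw [hf] at hfr₁ hfr₂
  have hzeros : ∃ y₁ y₂, r₁ ^ k ≤ y₁ ∧ y₁ < y₂ ∧ y₂ ≤ r₂ ^ k ∧ y₂ < ε ∧
      α * δ - (β * y₁ - γ) * (ε - y₁) = 0 ∧ α * δ - (β * y₂ - γ) * (ε - y₂) = 0 := by
    rcases lt_or_ge (α * xb ^ n - β * xb ^ k + γ) 0 with hneg | hnonneg
    · refine exists_two_zeros_of_neg hc hr₁k hr₂k hlt ?_ hga hgb
      rw [hcY, hεY]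
      nlinarith
    -- the second zero of the quadratic in `x ^ k` when `xb ^ k` is one of them
    set z : ℝ := (k : ℝ) / n * xb ^ k + γ / β with hz
    have hfac : α * xb ^ n - β * xb ^ k + γ = 0 → ∀ y : ℝ,
        α * δ - (β * y - γ) * (ε - y) = β * (y - xb ^ k) * (y - z) := by
      intro h0 y
      have hγβ : β * (γ / β) = γ := by field_simp
      have hAe : α * xb ^ n = β * xb ^ k - γ := by linarith
      rw [hcY, hεY, hz, hAe]
      linear_combination (y - xb ^ k) * hγβ
    have hβz : n * (β * z) = k * (β * xb ^ k) + n * γ := by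
      rw [hz]
      field_simp
    rcases hxb1.eq_or_lt with rfl | hr₁X
    · have hd := trinomial_deriv_neg_of_lt_root hk1 hkn hα hr₁ hr₁₂ hfr₂ hnonneg
      have hYz : r₁ ^ k < z := by
        refine lt_of_mul_lt_mul_left (a := n * β) ?_ (by positivity)
        nlinarith
      have hzε : z < ε := by
        have : γ / β < r₁ ^ k := by
          rw [div_lt_iff₀ hβ]
          linarith
        linarith
      refine ⟨r₁ ^ k, z, le_rfl, hYz, ?_, hzε, ?_, ?_⟩
      · rcases lt_or_ge (r₂ ^ k) ε with hlt₂ | hge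
        · have h2 := hgb hlt₂
          rw [hfac hfr₁] at h2
          have h3 : r₁ ^ k < r₂ ^ k := pow_lt_pow_left₀ hr₁₂ hr₁.le (by omega)
          have h4 := nonneg_of_mul_nonneg_right h2 (mul_pos hβ (sub_pos.mpr h3))
          linarith
        · linarith
      · simp [hfac hfr₁]
      · simp [hfac hfr₁]
    · have hd := trinomial_deriv_pos_of_root_lt hk1 hkn hα hr₁ hr₁X hfr₁ hnonneg
      rcases hxb2.eq_or_lt with rfl | hXr₂
      · have hzY : z < xb ^ k := by
          refine lt_of_mul_lt_mul_left (a := n * β) ?_ (by positivity)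
          nlinarith
        refine ⟨z, xb ^ k, ?_, hzY, le_rfl, hlt, ?_, ?_⟩
        · rw [hfac hfr₂] at hga
          have h3 : r₁ ^ k < xb ^ k := pow_lt_pow_left₀ hr₁X hr₁.le (by omega)
          have h4 : 0 < β * (xb ^ k - r₁ ^ k) := mul_pos hβ (sub_pos.mpr h3)
          by_contra! hcon
          have h5 := mul_pos h4 (sub_pos.mpr hcon)
          linarith
        · simp [hfac hfr₂]
        · simp [hfac hfr₂]
      · exact absurd hd
          (trinomial_deriv_neg_of_lt_root hk1 hkn hα hX hXr₂ hfr₂ hnonneg).not_gt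
  obtain ⟨y₁, y₂, hy₁, hy₁₂, hy₂, hy₂ε, hgy₁, hgy₂⟩ := hzeros
  have hy₁0 : 0 < y₁ := (pow_pos hr₁ k).trans_le hy₁
  have hroot : ∀ y : ℝ, 0 < y → ∃ s : ℝ, 0 ≤ s ∧ s ^ k = y := fun y hy =>
    ⟨y ^ (k : ℝ)⁻¹, by positivity, Real.rpow_inv_natCast_pow hy.le (by omega)⟩
  obtain ⟨s₁, hs₁, rfl⟩ := hroot y₁ hy₁0
  obtain ⟨s₂, hs₂, rfl⟩ := hroot y₂ (hy₁0.trans hy₁₂)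
  have hzero : ∀ s : ℝ, s ^ k < ε →
      α * δ - (β * s ^ k - γ) * (ε - s ^ k) = 0 → h s = 0 := by
    intro s hs hg
    rw [← hhg s hs] at hg
    exact (mul_eq_zero.mp hg).resolve_right (by linarith)
  exact ⟨hlt, hmaj, s₁, s₂, le_of_pow_le_pow_left₀ (by omega) hs₁ hy₁,
    lt_of_pow_lt_pow_left₀ k hs₂ hy₁₂,
    le_of_pow_le_pow_left₀ (by omega) (hr₁.trans hr₁₂).le hy₂,
    hzero s₁ (hy₁₂.trans hy₂ε) hgy₁, hzero s₂ hy₂ε hgy₂⟩
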